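/- Let c, k_N, k_{N+1} ≥ 0 and a = ∫₀^{π/2} cos^{k_N} θ sin^{k_{N+1}} θ dθ. If Q ⊂ W_{N+1} is a set whose slice at each x' ∈ M' ⊆ ℝ^{N-1}_+ is the quarter disc of radius R(x') in the (x_N, x_{N+1})-quadrant, and K = {(x', r) : 0 < r < R(x'), x' ∈ M'} ⊂ W_N, then μ(Q) = α(K) and P_μ(Q, W_{N+1}) = P_α(K, W_N), where dμ = e^{c|y|²} ∏_{i=1}^{N+1} y_i^{k_i} dy and dα = a · r^{k_N+k_{N+1}+1} e^{c(|x'|²+r²)} dx' dr. -/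

import Mathlib

open Real Set MeasureTheory

/-- Weighted perimeter of `M` relative to the open set `Ω`, with weight `φ`. -/
noncomputable def wPerim {d : ℕ} (φ : EuclideanSpace ℝ (Fin d) → ℝ)
    (Ω M : Set (EuclideanSpace ℝ (Fin d))) : ℝ :=
  sSup { P : ℝ | ∃ v : EuclideanSpace ℝ (Fin d) → EuclideanSpace ℝ (Fin d),
    ContDiff ℝ 1 v ∧ HasCompactSupport v ∧ tsupport v ⊆ Ω ∧ (∀ x, ‖v x‖ ≤ 1) ∧
    P = ∫ x in M, ∑ i, fderiv ℝ (fun y => φ y * v y i) x (EuclideanSpace.single i 1) }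

theorem measurePreserving_finAppend_symm (n m : ℕ) :
    MeasurePreserving (fun x : Fin (n + m) → ℝ =>
      ((fun i => x (Fin.castAdd m i)), (fun j => x (Fin.natAdd n j)))) := by
  have h1 := (volume_measurePreserving_piCongrLeft (fun _ : Fin (n + m) => ℝ)
    (finSumFinEquiv (m := n) (n := m))).symm
  have h2 := volume_measurePreserving_sumPiEquivProdPi (fun _ : Fin n ⊕ Fin m => ℝ)
  have h3 := h2.comp h1
  exact h3

theorem measurePreserving_split_two (n : ℕ) :
    MeasurePreserving (fun x : EuclideanSpace ℝ (Fin (n + 2)) =>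
      ((fun i => x (Fin.castAdd 2 i)), (x (Fin.natAdd n 0), x (Fin.natAdd n 1)))) :=
  (((MeasurePreserving.id volume).prod (volume_preserving_finTwoArrow ℝ)).comp
    (measurePreserving_finAppend_symm n 2)).comp (PiLp.volume_preserving_ofLp (Fin (n + 2)))

theorem measurePreserving_split_one (n : ℕ) :
    MeasurePreserving (fun x : EuclideanSpace ℝ (Fin (n + 1)) =>
      ((fun i => x (Fin.castAdd 1 i)), x (Fin.natAdd n 0))) :=
  (((MeasurePreserving.id volume).prod (volume_preserving_funUnique (Fin 1) ℝ)).comp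
    (measurePreserving_finAppend_symm n 1)).comp (PiLp.volume_preserving_ofLp (Fin (n + 1)))

theorem restrict_eq_map_of_domRestrict {α β : Type*} [MeasurableSpace α] [MeasurableSpace β]
    {f : α → β} {s : Set α} (hs : MeasurableSet s) (hfm : Measurable f)
    (hf : MeasurableEmbedding (s.domRestrict f)) {μ : Measure α} {ν : Measure β}
    (h : (μ.restrict s).map f = ν) (Q : Set β) :
    ν.restrict Q = (μ.restrict (s ∩ f ⁻¹' Q)).map f := by
  have h1 : ∀ A : Set β, ν A = μ (s ∩ f ⁻¹' A) := by
    intro A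
    rw [← h, ← map_comap_subtype_coe hs, Measure.map_map hfm measurable_subtype_coe]
    have : f ∘ ((↑) : s → α) = s.domRestrict f := rfl
    rw [this, hf.map_apply, comap_subtype_coe_apply hs]
    congr 1
    ext x
    simp [and_comm]
  ext t ht
  rw [Measure.restrict_apply ht, Measure.map_apply hfm ht, Measure.restrict_apply (hfm ht), h1]
  congr 1
  ext x
  simp
  tauto

theorem lintegral_quadrant_eq (f : ℝ × ℝ → ENNReal) :
    ∫⁻ p in Ioi (0:ℝ) ×ˢ Ioi (0:ℝ), f p =
      ∫⁻ p in Ioi (0:ℝ) ×ˢ Ioo (0:ℝ) (π / 2),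
        ENNReal.ofReal p.1 * f (p.1 * cos p.2, p.1 * sin p.2) := by
  have hq : MeasurableSet (Ioi (0:ℝ) ×ˢ Ioi (0:ℝ)) := measurableSet_Ioi.prod measurableSet_Ioi
  have ht : MeasurableSet (Ioi (0:ℝ) ×ˢ Ioo (0:ℝ) (π / 2)) :=
    measurableSet_Ioi.prod measurableSet_Ioo
  rw [← lintegral_indicator hq, ← lintegral_comp_polarCoord_symm, ← lintegral_indicator ht,
    ← lintegral_indicator polarCoord.open_target.measurableSet]
  congr 1
  ext ⟨r, θ⟩
  have hpi := pi_pos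
  by_cases h : (r, θ) ∈ Ioi (0:ℝ) ×ˢ Ioo (0:ℝ) (π / 2)
  · rw [indicator_of_mem h]
    obtain ⟨h0, h1, h2⟩ := h
    simp only [mem_Ioi] at h0 h1 h2
    rw [indicator_of_mem, polarCoord_symm_apply, indicator_of_mem, smul_eq_mul]
    · exact ⟨mul_pos h0 (cos_pos_of_mem_Ioo ⟨by linarith, h2⟩),
        mul_pos h0 (sin_pos_of_pos_of_lt_pi h1 (by linarith))⟩
    · exact ⟨h0, by simp only; linarith, by simp only; linarith⟩
  · rw [indicator_of_notMem h]
    by_cases h' : (r, θ) ∈ polarCoord.target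
    · rw [indicator_of_mem h', polarCoord_symm_apply, indicator_of_notMem, smul_zero]
      contrapose! h
      obtain ⟨h0, h1, h2⟩ := h'
      simp only [mem_Ioi] at h0 h1 h2
      obtain ⟨h3, h4⟩ := h
      simp only [mem_Ioi] at h3 h4
      have h3 := pos_of_mul_pos_right h3 h0.le
      have h4 := pos_of_mul_pos_right h4 h0.le
      refine ⟨h0, ?_, ?_⟩
      · by_contra hh
        exact absurd h4 (not_lt.2 (sin_nonpos_of_nonpos_of_neg_pi_le (not_lt.1 hh) h1.le))
      · by_contra hh
        exact absurd h3 (not_lt.2 (cos_nonpos_of_pi_div_two_le_of_le (not_lt.1 hh) (by linarith)))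
    · rw [indicator_of_notMem h']

/-- The positive orthant of Euclidean space. -/
def posOrthant (d : ℕ) : Set (EuclideanSpace ℝ (Fin d)) := {x | ∀ i, 0 < x i}

/-- The point of `ℝⁿ⁺²` with coordinates `(z, r cos θ, r sin θ)`, where `y = (z, r)`. -/
noncomputable def polarMap (n : ℕ) (y : EuclideanSpace ℝ (Fin (n + 1))) (θ : ℝ) :
    EuclideanSpace ℝ (Fin (n + 2)) :=
  WithLp.toLp 2 (Fin.append (fun i => y (Fin.castAdd 1 i))
    ![y (Fin.natAdd n 0) * cos θ, y (Fin.natAdd n 0) * sin θ])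

@[simp] theorem polarMap_castAdd (n : ℕ) (y : EuclideanSpace ℝ (Fin (n + 1))) (θ : ℝ) (i : Fin n) :
    polarMap n y θ (Fin.castAdd 2 i) = y (Fin.castAdd 1 i) := by
  simp only [polarMap, Fin.append_left]

@[simp] theorem polarMap_zero (n : ℕ) (y : EuclideanSpace ℝ (Fin (n + 1))) (θ : ℝ) :
    polarMap n y θ (Fin.natAdd n 0) = y (Fin.natAdd n 0) * cos θ := by
  simp only [polarMap, Fin.append_right]; rfl

@[simp] theorem polarMap_one (n : ℕ) (y : EuclideanSpace ℝ (Fin (n + 1))) (θ : ℝ) :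
    polarMap n y θ (Fin.natAdd n 1) = y (Fin.natAdd n 0) * sin θ := by
  simp only [polarMap, Fin.append_right]; rfl

theorem forall_fin_add_two {n : ℕ} {P : Fin (n + 2) → Prop} :
    (∀ i, P i) ↔ (∀ i : Fin n, P (Fin.castAdd 2 i)) ∧ P (Fin.natAdd n 0) ∧ P (Fin.natAdd n 1) := by
  refine ⟨fun h => ⟨fun i => h _, h _, h _⟩, fun h i => ?_⟩
  induction i using Fin.addCases with
  | left i => exact h.1 i
  | right j => fin_cases j; exacts [h.2.1, h.2.2]

theorem forall_fin_add_one {n : ℕ} {P : Fin (n + 1) → Prop} :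
    (∀ i, P i) ↔ (∀ i : Fin n, P (Fin.castAdd 1 i)) ∧ P (Fin.natAdd n 0) := by
  refine ⟨fun h => ⟨fun i => h _, h _⟩, fun h i => ?_⟩
  induction i using Fin.addCases with
  | left i => exact h.1 i
  | right j => fin_cases j; exact h.2

theorem mem_posOrthant_add_two {n : ℕ} {x : EuclideanSpace ℝ (Fin (n + 2))} :
    x ∈ posOrthant (n + 2) ↔
      (∀ i : Fin n, 0 < x (Fin.castAdd 2 i)) ∧ 0 < x (Fin.natAdd n 0) ∧ 0 < x (Fin.natAdd n 1) :=
  forall_fin_add_two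

theorem mem_posOrthant_add_one {n : ℕ} {x : EuclideanSpace ℝ (Fin (n + 1))} :
    x ∈ posOrthant (n + 1) ↔ (∀ i : Fin n, 0 < x (Fin.castAdd 1 i)) ∧ 0 < x (Fin.natAdd n 0) :=
  forall_fin_add_one

theorem isOpen_posOrthant (d : ℕ) : IsOpen (posOrthant d) := by
  have : posOrthant d = ⋂ i, {x | 0 < x i} := by ext; simp [posOrthant]
  rw [this]
  exact isOpen_iInter_of_finite fun i => isOpen_lt continuous_const (by fun_prop)

theorem contDiff_polarMap (n : ℕ) {m : WithTop ℕ∞} :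
    ContDiff ℝ m (fun p : EuclideanSpace ℝ (Fin (n + 1)) × ℝ => polarMap n p.1 p.2) := by
  rw [contDiff_euclidean, forall_fin_add_two]
  simp only [polarMap_castAdd, polarMap_zero, polarMap_one]
  have h : ∀ i : Fin (n + 1), ContDiff ℝ m
      (fun p : EuclideanSpace ℝ (Fin (n + 1)) × ℝ => p.1 i) := fun i =>
    (EuclideanSpace.proj (𝕜 := ℝ) i).contDiff.comp contDiff_fst
  exact ⟨fun i => h _, (h _).mul (contDiff_cos.comp contDiff_snd),
    (h _).mul (contDiff_sin.comp contDiff_snd)⟩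

theorem polarMap_mem_posOrthant {n : ℕ} {y : EuclideanSpace ℝ (Fin (n + 1))} {θ : ℝ}
    (hy : y ∈ posOrthant (n + 1)) (hθ : θ ∈ Ioo 0 (π / 2)) :
    polarMap n y θ ∈ posOrthant (n + 2) := by
  have hpi := pi_pos
  rw [mem_posOrthant_add_one] at hy
  rw [mem_posOrthant_add_two]
  simp only [polarMap_castAdd, polarMap_zero, polarMap_one]
  exact ⟨hy.1, mul_pos hy.2 (cos_pos_of_mem_Ioo ⟨by linarith [hθ.1], hθ.2⟩),
    mul_pos hy.2 (sin_pos_of_pos_of_lt_pi hθ.1 (by linarith [hθ.2]))⟩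

theorem setLIntegral_posOrthant_eq (n : ℕ) {f : EuclideanSpace ℝ (Fin (n + 2)) → ENNReal}
    (hf : Measurable f) :
    ∫⁻ x in posOrthant (n + 2), f x =
      ∫⁻ y in posOrthant (n + 1), ∫⁻ θ in Ioo (0:ℝ) (π / 2),
        ENNReal.ofReal (y (Fin.natAdd n 0)) * f (polarMap n y θ) := by
  let S : (Fin n → ℝ) × (ℝ × ℝ) → EuclideanSpace ℝ (Fin (n + 2)) := fun z =>
    WithLp.toLp 2 (Fin.append z.1 ![z.2.1, z.2.2])
  have hS : Continuous S := by
    refine (PiLp.continuous_toLp 2 _).comp (continuous_pi ?_)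
    rw [forall_fin_add_two]
    simp only [Fin.append_left, Fin.append_right]
    exact ⟨fun i => by fun_prop, continuous_snd.fst, continuous_snd.snd⟩
  let X : Set (Fin n → ℝ) := {x | ∀ i, 0 < x i}
  have hX : MeasurableSet X := by
    have : X = ⋂ i, {x | 0 < x i} := by ext; simp [X]
    rw [this]
    exact MeasurableSet.iInter fun i => measurableSet_lt measurable_const (measurable_pi_apply i)
  have hfS : Measurable fun z => f (S z) := hf.comp hS.measurable
  have h2 := (measurePreserving_split_two n).setLIntegral_comp_preimage
    (s := X ×ˢ (Ioi (0:ℝ) ×ˢ Ioi (0:ℝ)))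
    (hX.prod (measurableSet_Ioi.prod measurableSet_Ioi)) hfS
  have e2 : (fun x : EuclideanSpace ℝ (Fin (n + 2)) =>
      ((fun i => x (Fin.castAdd 2 i)), (x (Fin.natAdd n 0), x (Fin.natAdd n 1)))) ⁻¹'
      (X ×ˢ (Ioi (0:ℝ) ×ˢ Ioi (0:ℝ))) = posOrthant (n + 2) := by
    ext x; rw [mem_posOrthant_add_two]; simp [X]
  have e3 : ∀ x : EuclideanSpace ℝ (Fin (n + 2)), S ((fun i => x (Fin.castAdd 2 i)),
      (x (Fin.natAdd n 0), x (Fin.natAdd n 1))) = x := by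
    intro x
    ext i
    revert i
    rw [forall_fin_add_two]
    simp only [S, Fin.append_left, Fin.append_right]
    exact ⟨fun i => trivial, rfl, rfl⟩
  simp only [e3] at h2
  rw [e2] at h2
  let g : (Fin n → ℝ) × ℝ → ENNReal := fun z => ∫⁻ θ in Ioo (0:ℝ) (π / 2),
    ENNReal.ofReal z.2 * f (S (z.1, (z.2 * cos θ, z.2 * sin θ)))
  have hgm' : Measurable (fun w : ((Fin n → ℝ) × ℝ) × ℝ =>
      ENNReal.ofReal w.1.2 * f (S (w.1.1, (w.1.2 * cos w.2, w.1.2 * sin w.2)))) :=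
    (by fun_prop : Measurable fun w : ((Fin n → ℝ) × ℝ) × ℝ => ENNReal.ofReal w.1.2).mul
      (hf.comp (hS.measurable.comp (by fun_prop)))
  have hgm : Measurable g := hgm'.lintegral_prod_right'
  have h1 := (measurePreserving_split_one n).setLIntegral_comp_preimage
    (s := X ×ˢ Ioi (0:ℝ)) (hX.prod measurableSet_Ioi) hgm
  have e1 : (fun x : EuclideanSpace ℝ (Fin (n + 1)) =>
      ((fun i => x (Fin.castAdd 1 i)), x (Fin.natAdd n 0))) ⁻¹'
      (X ×ˢ Ioi (0:ℝ)) = posOrthant (n + 1) := by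
    ext x; rw [mem_posOrthant_add_one]; simp [X]
  rw [e1] at h1
  refine h2.trans (Eq.trans ?_ h1.symm)
  change _ = ∫⁻ z : (Fin n → ℝ) × ℝ in X ×ˢ Ioi (0:ℝ), g z
  rw [Measure.volume_eq_prod, Measure.volume_eq_prod, ← Measure.prod_restrict,
    ← Measure.prod_restrict, lintegral_prod _ hfS.aemeasurable,
    Measure.volume_eq_prod (Fin n → ℝ) ℝ, ← Measure.prod_restrict,
    lintegral_prod _ hgm.aemeasurable]
  refine lintegral_congr fun x => ?_
  rw [Measure.prod_restrict, ← Measure.volume_eq_prod, lintegral_quadrant_eq,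
    Measure.volume_eq_prod, ← Measure.prod_restrict, lintegral_prod]
  exact (hgm'.comp (by fun_prop : Measurable fun p : ℝ × ℝ => ((x, p.1), p.2))).aemeasurable

theorem injOn_polarMap (n : ℕ) :
    InjOn (fun p : EuclideanSpace ℝ (Fin (n + 1)) × ℝ => polarMap n p.1 p.2)
      (posOrthant (n + 1) ×ˢ Ioo 0 (π / 2)) := by
  rintro ⟨y, θ⟩ ⟨hy, hθ⟩ ⟨z, η⟩ ⟨hz, hη⟩ h
  have hpi := pi_pos
  simp only at h hy hz hθ hη
  have h' : ∀ i, polarMap n y θ i = polarMap n z η i := fun i => by rw [h]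
  rw [forall_fin_add_two] at h'
  simp only [polarMap_castAdd, polarMap_zero, polarMap_one] at h'
  obtain ⟨h1, h2, h3⟩ := h'
  rw [mem_posOrthant_add_one] at hy hz
  have hr : y (Fin.natAdd n 0) = z (Fin.natAdd n 0) := by
    rw [← sq_eq_sq₀ hy.2.le hz.2.le]
    linear_combination (-y (Fin.natAdd n 0) ^ 2) * sin_sq_add_cos_sq θ +
      z (Fin.natAdd n 0) ^ 2 * sin_sq_add_cos_sq η +
      (y (Fin.natAdd n 0) * cos θ + z (Fin.natAdd n 0) * cos η) * h2 +
      (y (Fin.natAdd n 0) * sin θ + z (Fin.natAdd n 0) * sin η) * h3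
  rw [hr] at h2
  have hc : cos θ = cos η := mul_left_cancel₀ hz.2.ne' h2
  have hθη : θ = η := injOn_cos ⟨hθ.1.le, by linarith [hθ.2]⟩ ⟨hη.1.le, by linarith [hη.2]⟩ hc
  have hyz : y = z := by
    ext i
    revert i
    rw [forall_fin_add_one]
    exact ⟨h1, hr⟩
  rw [hyz, hθη]

theorem restrict_eq_map_polarMap (n : ℕ) {Q : Set (EuclideanSpace ℝ (Fin (n + 2)))}
    {K : Set (EuclideanSpace ℝ (Fin (n + 1)))} (hQ : Q ⊆ posOrthant (n + 2))
    (hK : K ⊆ posOrthant (n + 1))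
    (hQK : ∀ y ∈ posOrthant (n + 1), ∀ θ ∈ Ioo (0:ℝ) (π / 2), polarMap n y θ ∈ Q ↔ y ∈ K) :
    volume.restrict Q =
      (((volume.restrict K).prod (volume.restrict (Ioo (0:ℝ) (π / 2)))).withDensity
        (fun p => ENNReal.ofReal (p.1 (Fin.natAdd n 0)))).map (fun p => polarMap n p.1 p.2) := by
  have hs : MeasurableSet (posOrthant (n + 1) ×ˢ Ioo (0:ℝ) (π / 2)) :=
    (isOpen_posOrthant _).measurableSet.prod measurableSet_Ioo
  have hm : Measurable (fun p : EuclideanSpace ℝ (Fin (n + 1)) × ℝ =>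
    ENNReal.ofReal (p.1 (Fin.natAdd n 0))) := by fun_prop
  have hcont := (contDiff_polarMap n (m := 0)).continuous
  have key := restrict_eq_map_of_domRestrict hs hcont.measurable
    (hcont.continuousOn.measurableEmbedding hs (injOn_polarMap n))
    (μ := ((volume : Measure (EuclideanSpace ℝ (Fin (n + 1)))).prod
      (volume : Measure ℝ)).withDensity (fun p => ENNReal.ofReal (p.1 (Fin.natAdd n 0))))
    (ν := volume.restrict (posOrthant (n + 2))) ?_ Q
  · rw [Measure.restrict_restrict_of_subset hQ] at key
    rw [key, restrict_withDensity', Measure.prod_restrict]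
    congr 3
    ext ⟨y, θ⟩
    simp only [mem_inter_iff, mem_prod, mem_preimage]
    constructor
    · rintro ⟨⟨hy, hθ⟩, h⟩
      exact ⟨(hQK y hy θ hθ).1 h, hθ⟩
    · rintro ⟨hy, hθ⟩
      exact ⟨⟨hK hy, hθ⟩, (hQK y (hK hy) θ hθ).2 hy⟩
  · refine Measure.ext_of_lintegral _ fun f hf => ?_
    have hfc : Measurable fun p : EuclideanSpace ℝ (Fin (n + 1)) × ℝ => f (polarMap n p.1 p.2) :=
      hf.comp hcont.measurable
    rw [lintegral_map hf hcont.measurable, restrict_withDensity',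
      lintegral_withDensity_eq_lintegral_mul _ hm hfc,
      setLIntegral_posOrthant_eq n hf, ← Measure.prod_restrict, lintegral_prod]
    · rfl
    · exact (hm.mul hfc).aemeasurable

theorem ae_restrict_prod_mem {n : ℕ} {K : Set (EuclideanSpace ℝ (Fin (n + 1)))}
    (hK : K ⊆ posOrthant (n + 1)) :
    ∀ᵐ p ∂((volume : Measure (EuclideanSpace ℝ (Fin (n + 1)))).restrict K).prod
      ((volume : Measure ℝ).restrict (Ioo 0 (π / 2))),
      p.1 ∈ posOrthant (n + 1) ∧ p.2 ∈ Ioo 0 (π / 2) := by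
  rw [Measure.prod_restrict]
  refine ae_mono (Measure.restrict_mono (prod_mono_left hK) le_rfl) ?_
  exact ae_restrict_mem ((isOpen_posOrthant _).measurableSet.prod measurableSet_Ioo)

section PolarIntegral

variable {n : ℕ} {Q : Set (EuclideanSpace ℝ (Fin (n + 2)))}
  {K : Set (EuclideanSpace ℝ (Fin (n + 1)))} {f : EuclideanSpace ℝ (Fin (n + 2)) → ℝ}

theorem setIntegral_eq_integral_polarMap (hQ : Q ⊆ posOrthant (n + 2))
    (hK : K ⊆ posOrthant (n + 1))
    (hQK : ∀ y ∈ posOrthant (n + 1), ∀ θ ∈ Ioo (0:ℝ) (π / 2), polarMap n y θ ∈ Q ↔ y ∈ K)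
    (hf : Measurable f) :
    ∫ x in Q, f x = ∫ p, p.1 (Fin.natAdd n 0) * f (polarMap n p.1 p.2)
      ∂((volume.restrict K).prod (volume.restrict (Ioo (0:ℝ) (π / 2)))) := by
  have hcont := (contDiff_polarMap n (m := 0)).continuous
  rw [restrict_eq_map_polarMap n hQ hK hQK, integral_map hcont.measurable.aemeasurable
    hf.aestronglyMeasurable, integral_withDensity_eq_integral_toReal_smul (by fun_prop)
    (by simp)]
  refine integral_congr_ae ?_
  filter_upwards [ae_restrict_prod_mem hK] with p hp
  rw [ENNReal.toReal_ofReal (hp.1 _).le, smul_eq_mul]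

theorem integrable_polarMap_of_integrableOn (hQ : Q ⊆ posOrthant (n + 2))
    (hK : K ⊆ posOrthant (n + 1))
    (hQK : ∀ y ∈ posOrthant (n + 1), ∀ θ ∈ Ioo (0:ℝ) (π / 2), polarMap n y θ ∈ Q ↔ y ∈ K)
    (hf : IntegrableOn f Q) :
    Integrable (fun p => p.1 (Fin.natAdd n 0) * f (polarMap n p.1 p.2))
      ((volume.restrict K).prod (volume.restrict (Ioo (0:ℝ) (π / 2)))) := by
  have hcont := (contDiff_polarMap n (m := 0)).continuous
  rw [IntegrableOn, restrict_eq_map_polarMap n hQ hK hQK] at hf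
  have h := hf.comp_measurable hcont.measurable
  rw [integrable_withDensity_iff_integrable_smul' (by fun_prop) (by simp)] at h
  refine h.congr ?_
  filter_upwards [ae_restrict_prod_mem hK] with p hp
  rw [ENNReal.toReal_ofReal (hp.1 _).le, smul_eq_mul, Function.comp_apply]

end PolarIntegral

/-- The weight `exp (c ‖x‖²) ∏ xᵢ ^ kᵢ`. -/
noncomputable def monomialExpWeight {d : ℕ} (c : ℝ) (k : Fin d → ℝ)
    (x : EuclideanSpace ℝ (Fin d)) : ℝ :=
  exp (c * ‖x‖ ^ 2) * ∏ i, x i ^ k i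

/-- The density `cos ^ p * sin ^ q` on the quarter circle. -/
noncomputable def angularWeight {n : ℕ} (k : Fin (n + 2) → ℝ) (θ : ℝ) : ℝ :=
  cos θ ^ k (Fin.natAdd n 0) * sin θ ^ k (Fin.natAdd n 1)

/-- The weight obtained from `monomialExpWeight` by integrating over quarter circles in the last
two variables. -/
noncomputable def reducedWeight {n : ℕ} (a c : ℝ) (k : Fin (n + 2) → ℝ)
    (y : EuclideanSpace ℝ (Fin (n + 1))) : ℝ :=
  a * y (Fin.natAdd n 0) ^ (k (Fin.natAdd n 0) + k (Fin.natAdd n 1) + 1) *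
    exp (c * ‖y‖ ^ 2) * ∏ i : Fin n, y (Fin.castAdd 1 i) ^ k (Fin.castAdd 2 i)

theorem norm_sq_add_two {n : ℕ} (x : EuclideanSpace ℝ (Fin (n + 2))) :
    ‖x‖ ^ 2 = ∑ i : Fin n, x (Fin.castAdd 2 i) ^ 2 +
      (x (Fin.natAdd n 0) ^ 2 + x (Fin.natAdd n 1) ^ 2) := by
  rw [EuclideanSpace.real_norm_sq_eq, Fin.sum_univ_add, Fin.sum_univ_two]

theorem norm_sq_add_one {n : ℕ} (y : EuclideanSpace ℝ (Fin (n + 1))) :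
    ‖y‖ ^ 2 = ∑ i : Fin n, y (Fin.castAdd 1 i) ^ 2 + y (Fin.natAdd n 0) ^ 2 := by
  rw [EuclideanSpace.real_norm_sq_eq, Fin.sum_univ_add, Fin.sum_univ_one]

theorem norm_polarMap (n : ℕ) (y : EuclideanSpace ℝ (Fin (n + 1))) (θ : ℝ) :
    ‖polarMap n y θ‖ = ‖y‖ := by
  rw [← sq_eq_sq₀ (norm_nonneg _) (norm_nonneg _), norm_sq_add_two, norm_sq_add_one]
  simp only [polarMap_castAdd, polarMap_zero, polarMap_one]
  linear_combination y (Fin.natAdd n 0) ^ 2 * sin_sq_add_cos_sq θ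

theorem mul_monomialExpWeight_polarMap {n : ℕ} (a c : ℝ) (k : Fin (n + 2) → ℝ)
    {y : EuclideanSpace ℝ (Fin (n + 1))} (hy : y ∈ posOrthant (n + 1)) {θ : ℝ}
    (hθ : θ ∈ Icc 0 (π / 2)) :
    a * (y (Fin.natAdd n 0) * monomialExpWeight c k (polarMap n y θ)) =
      reducedWeight a c k y * angularWeight k θ := by
  have hpi := pi_pos
  have hr : 0 < y (Fin.natAdd n 0) := hy _
  have hcos : 0 ≤ cos θ := cos_nonneg_of_mem_Icc ⟨by linarith [hθ.1], hθ.2⟩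
  have hsin : 0 ≤ sin θ := sin_nonneg_of_nonneg_of_le_pi hθ.1 (by linarith [hθ.2])
  rw [monomialExpWeight, reducedWeight, angularWeight, norm_polarMap, Fin.prod_univ_add,
    Fin.prod_univ_two]
  simp only [polarMap_castAdd, polarMap_zero, polarMap_one]
  rw [mul_rpow hr.le hcos, mul_rpow hr.le hsin, rpow_add_one hr.ne', rpow_add hr]
  ring

theorem measurable_monomialExpWeight {d : ℕ} (c : ℝ) (k : Fin d → ℝ) :
    Measurable (monomialExpWeight c k) := by
  unfold monomialExpWeight
  fun_prop

theorem continuous_angularWeight {n : ℕ} {k : Fin (n + 2) → ℝ} (hk : ∀ i, 0 ≤ k i) :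
    Continuous (angularWeight k) :=
  (continuous_cos.rpow_const fun _ => Or.inr (hk _)).mul
    (continuous_sin.rpow_const fun _ => Or.inr (hk _))

theorem angularWeight_pos {n : ℕ} (k : Fin (n + 2) → ℝ) {θ : ℝ} (hθ : θ ∈ Ioo 0 (π / 2)) :
    0 < angularWeight k θ := by
  have hpi := pi_pos
  exact mul_pos (rpow_pos_of_pos (cos_pos_of_mem_Ioo ⟨by linarith [hθ.1], hθ.2⟩) _)
    (rpow_pos_of_pos (sin_pos_of_pos_of_lt_pi hθ.1 (by linarith [hθ.2])) _)

theorem angularWeight_nonneg {n : ℕ} (k : Fin (n + 2) → ℝ) {θ : ℝ} (hθ : θ ∈ Icc 0 (π / 2)) :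
    0 ≤ angularWeight k θ := by
  have hpi := pi_pos
  exact mul_nonneg (rpow_nonneg (cos_nonneg_of_mem_Icc ⟨by linarith [hθ.1], hθ.2⟩) _)
    (rpow_nonneg (sin_nonneg_of_nonneg_of_le_pi hθ.1 (by linarith [hθ.2])) _)

theorem integral_angularWeight_pos {n : ℕ} {k : Fin (n + 2) → ℝ} (hk : ∀ i, 0 ≤ k i) :
    0 < ∫ θ in (0:ℝ)..(π / 2), angularWeight k θ :=
  intervalIntegral.intervalIntegral_pos_of_pos_on
    ((continuous_angularWeight hk).intervalIntegrable _ _) (fun _ hθ => angularWeight_pos k hθ)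
    (by positivity)

theorem setIntegral_monomialExpWeight_eq {n : ℕ} {Q : Set (EuclideanSpace ℝ (Fin (n + 2)))}
    {K : Set (EuclideanSpace ℝ (Fin (n + 1)))} (hQ : Q ⊆ posOrthant (n + 2))
    (hK : K ⊆ posOrthant (n + 1))
    (hQK : ∀ y ∈ posOrthant (n + 1), ∀ θ ∈ Ioo (0:ℝ) (π / 2), polarMap n y θ ∈ Q ↔ y ∈ K)
    {a : ℝ} (c : ℝ) {k : Fin (n + 2) → ℝ} (hk : ∀ i, 0 ≤ k i)
    (ha : a = ∫ θ in (0:ℝ)..(π / 2), angularWeight k θ) :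
    ∫ x in Q, monomialExpWeight c k x = ∫ y in K, reducedWeight a c k y := by
  have ha0 : 0 < a := ha ▸ integral_angularWeight_pos hk
  rw [setIntegral_eq_integral_polarMap hQ hK hQK (measurable_monomialExpWeight c k)]
  have h : ∀ᵐ p ∂((volume.restrict K).prod (volume.restrict (Ioo (0:ℝ) (π / 2)))),
      p.1 (Fin.natAdd n 0) * monomialExpWeight c k (polarMap n p.1 p.2) =
        (a⁻¹ * reducedWeight a c k p.1) * angularWeight k p.2 := by
    filter_upwards [ae_restrict_prod_mem hK] with p hp
    rw [mul_assoc, ← mul_monomialExpWeight_polarMap a c k hp.1 (Ioo_subset_Icc_self hp.2),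
      inv_mul_cancel_left₀ ha0.ne']
  rw [integral_congr_ae h, integral_prod_mul (fun y => a⁻¹ * reducedWeight a c k y),
    integral_const_mul, ← integral_Ioc_eq_integral_Ioo,
    ← intervalIntegral.integral_of_le (by positivity), ← ha]
  field_simp

section ParametricIntegral

variable {H G : Type*} [NormedAddCommGroup H] [NormedSpace ℝ H] [FiniteDimensional ℝ H]
  [NormedAddCommGroup G] [NormedSpace ℝ G]

theorem hasFDerivAt_intervalIntegral_smul {w : ℝ → ℝ} {g : H × ℝ → G} (hw : Continuous w)
    (hg : ContDiff ℝ 1 g) (a b : ℝ) (y : H) :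
    HasFDerivAt (fun y => ∫ θ in a..b, w θ • g (y, θ))
      (∫ θ in a..b, w θ • (fderiv ℝ g (y, θ)).comp (ContinuousLinearMap.inl ℝ H ℝ)) y := by
  have : ProperSpace H := FiniteDimensional.proper_real H
  have hF' : Continuous fun p : H × ℝ =>
      w p.2 • (fderiv ℝ g p).comp (ContinuousLinearMap.inl ℝ H ℝ) :=
    (hw.comp continuous_snd).smul ((hg.continuous_fderiv one_ne_zero).clm_comp continuous_const)
  have hF : Continuous fun p : H × ℝ => w p.2 • g p :=
    (hw.comp continuous_snd).smul hg.continuous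
  have hcomp : IsCompact (Metric.closedBall y 1 ×ˢ uIcc a b) :=
    (isCompact_closedBall y 1).prod isCompact_uIcc
  obtain ⟨C, hC⟩ := hcomp.exists_bound_of_continuousOn hF'.continuousOn
  refine (intervalIntegral.hasFDerivAt_integral_of_dominated_of_fderiv_le
    (F := fun y θ => w θ • g (y, θ))
    (F' := fun y θ => w θ • (fderiv ℝ g (y, θ)).comp (ContinuousLinearMap.inl ℝ H ℝ))
    (bound := fun _ => C) (s := Metric.ball y 1) (Metric.ball_mem_nhds y one_pos)
    ?_ ?_ ?_ ?_ ?_ ?_)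
  · exact Filter.Eventually.of_forall fun z =>
      (hF.comp (by fun_prop : Continuous fun θ : ℝ => (z, θ))).aestronglyMeasurable
  · exact (hF.comp (by fun_prop : Continuous fun θ : ℝ => (y, θ))).intervalIntegrable _ _
  · exact (hF'.comp (by fun_prop : Continuous fun θ : ℝ => (y, θ))).aestronglyMeasurable
  · exact Filter.Eventually.of_forall fun θ hθ z hz =>
      hC (z, θ) ⟨Metric.ball_subset_closedBall hz, uIoc_subset_uIcc hθ⟩
  · exact intervalIntegrable_const
  · refine Filter.Eventually.of_forall fun θ _ z _ => ?_
    refine HasFDerivAt.const_smul ?_ (w θ)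
    exact (hg.differentiable one_ne_zero (z, θ)).hasFDerivAt.comp z (hasFDerivAt_prodMk_left z θ)

theorem contDiff_intervalIntegral_smul {w : ℝ → ℝ} {g : H × ℝ → G} (hw : Continuous w)
    (hg : ContDiff ℝ 1 g) (a b : ℝ) :
    ContDiff ℝ 1 (fun y => ∫ θ in a..b, w θ • g (y, θ)) := by
  have h := hasFDerivAt_intervalIntegral_smul hw hg a b
  rw [contDiff_one_iff_fderiv]
  refine ⟨fun y => (h y).differentiableAt, ?_⟩
  rw [funext fun y => (h y).fderiv]
  refine intervalIntegral.continuous_parametric_intervalIntegral_of_continuous' ?_ a b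
  exact (hw.comp continuous_snd).smul
    ((hg.continuous_fderiv one_ne_zero).clm_comp continuous_const)

end ParametricIntegral

/-- The divergence, as a sum of partial derivatives of coordinates. -/
noncomputable def coordDiv {d : ℕ} (F : EuclideanSpace ℝ (Fin d) → EuclideanSpace ℝ (Fin d))
    (x : EuclideanSpace ℝ (Fin d)) : ℝ :=
  ∑ i, fderiv ℝ (fun y => F y i) x (EuclideanSpace.single i 1)

/-- The trace of an endomorphism of Euclidean space, as a continuous linear functional. -/
noncomputable def coordTrace (d : ℕ) :
    (EuclideanSpace ℝ (Fin d) →L[ℝ] EuclideanSpace ℝ (Fin d)) →L[ℝ] ℝ :=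
  ∑ i, (EuclideanSpace.proj i).comp
    (ContinuousLinearMap.apply ℝ (EuclideanSpace ℝ (Fin d)) (EuclideanSpace.single i (1:ℝ)))

theorem coordTrace_apply {d : ℕ} (A : EuclideanSpace ℝ (Fin d) →L[ℝ] EuclideanSpace ℝ (Fin d)) :
    coordTrace d A = ∑ i, A (EuclideanSpace.single i 1) i := by
  simp [coordTrace]

theorem HasFDerivAt.coordDiv_eq {d : ℕ}
    {F : EuclideanSpace ℝ (Fin d) → EuclideanSpace ℝ (Fin d)} {x : EuclideanSpace ℝ (Fin d)}
    {A : EuclideanSpace ℝ (Fin d) →L[ℝ] EuclideanSpace ℝ (Fin d)} (h : HasFDerivAt F A x) :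
    coordDiv F x = coordTrace d A := by
  rw [coordTrace_apply]
  refine Finset.sum_congr rfl fun i _ => ?_
  have := ((EuclideanSpace.proj (𝕜 := ℝ) i).hasFDerivAt (x := F x)).comp x h
  rw [show (fun y => F y i) = (EuclideanSpace.proj (𝕜 := ℝ) i) ∘ F from rfl, this.fderiv]
  rfl

theorem ContDiff.continuous_coordDiv {d : ℕ}
    {F : EuclideanSpace ℝ (Fin d) → EuclideanSpace ℝ (Fin d)} (hF : ContDiff ℝ 1 F) :
    Continuous (coordDiv F) := by
  rw [funext fun x => (hF.differentiable one_ne_zero x).hasFDerivAt.coordDiv_eq]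
  exact (coordTrace d).continuous.comp (hF.continuous_fderiv one_ne_zero)

theorem support_coordDiv_subset {d : ℕ}
    (F : EuclideanSpace ℝ (Fin d) → EuclideanSpace ℝ (Fin d)) :
    Function.support (coordDiv F) ⊆ tsupport F := by
  intro x hx
  by_contra h
  apply hx
  have h0 : F =ᶠ[nhds x] fun _ => 0 := notMem_tsupport_iff_eventuallyEq.1 h
  rw [((hasFDerivAt_const (0 : EuclideanSpace ℝ (Fin d)) x).congr_of_eventuallyEq h0).coordDiv_eq,
    map_zero]

theorem Filter.EventuallyEq.coordDiv_eq {d : ℕ}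
    {F G : EuclideanSpace ℝ (Fin d) → EuclideanSpace ℝ (Fin d)} {x : EuclideanSpace ℝ (Fin d)}
    (h : F =ᶠ[nhds x] G) : coordDiv F x = coordDiv G x := by
  refine Finset.sum_congr rfl fun i _ => ?_
  rw [Filter.EventuallyEq.fderiv_eq (h.mono fun y hy => by rw [hy])]

/-- `polarMap` as a linear map in the Euclidean variable. -/
noncomputable def polarMapCLM (n : ℕ) (θ : ℝ) :
    EuclideanSpace ℝ (Fin (n + 1)) →L[ℝ] EuclideanSpace ℝ (Fin (n + 2)) :=
  LinearMap.toContinuousLinearMap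
    { toFun := fun y => polarMap n y θ
      map_add' := fun y z => by
        ext i
        revert i
        rw [forall_fin_add_two]
        simp only [PiLp.add_apply, polarMap_castAdd, polarMap_zero, polarMap_one]
        exact ⟨fun _ => trivial, add_mul _ _ _, add_mul _ _ _⟩
      map_smul' := fun t y => by
        ext i
        revert i
        rw [forall_fin_add_two]
        simp [mul_assoc] }

theorem polarMapCLM_apply (n : ℕ) (θ : ℝ) (y : EuclideanSpace ℝ (Fin (n + 1))) :
    polarMapCLM n θ y = polarMap n y θ := rfl

/-- The projection `(w, s, t) ↦ (w, s cos θ + t sin θ)`, adjoint to `polarMap`. -/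
noncomputable def polarRadial (n : ℕ) (θ : ℝ) (z : EuclideanSpace ℝ (Fin (n + 2))) :
    EuclideanSpace ℝ (Fin (n + 1)) :=
  WithLp.toLp 2 (Fin.append (fun i => z (Fin.castAdd 2 i))
    ![z (Fin.natAdd n 0) * cos θ + z (Fin.natAdd n 1) * sin θ])

@[simp] theorem polarRadial_castAdd (n : ℕ) (θ : ℝ) (z : EuclideanSpace ℝ (Fin (n + 2)))
    (i : Fin n) : polarRadial n θ z (Fin.castAdd 1 i) = z (Fin.castAdd 2 i) := by
  simp only [polarRadial, Fin.append_left]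

@[simp] theorem polarRadial_zero (n : ℕ) (θ : ℝ) (z : EuclideanSpace ℝ (Fin (n + 2))) :
    polarRadial n θ z (Fin.natAdd n 0) =
      z (Fin.natAdd n 0) * cos θ + z (Fin.natAdd n 1) * sin θ := by
  simp only [polarRadial, Fin.append_right]; rfl

/-- `polarRadial` as a linear map in the Euclidean variable. -/
noncomputable def polarRadialCLM (n : ℕ) (θ : ℝ) :
    EuclideanSpace ℝ (Fin (n + 2)) →L[ℝ] EuclideanSpace ℝ (Fin (n + 1)) :=
  LinearMap.toContinuousLinearMap
    { toFun := polarRadial n θ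
      map_add' := fun y z => by
        ext i
        revert i
        rw [forall_fin_add_one]
        simp only [PiLp.add_apply, polarRadial_castAdd, polarRadial_zero]
        exact ⟨fun _ => trivial, by ring⟩
      map_smul' := fun t y => by
        ext i
        revert i
        rw [forall_fin_add_one]
        simp [mul_assoc, mul_add] }

theorem polarRadialCLM_apply (n : ℕ) (θ : ℝ) (z : EuclideanSpace ℝ (Fin (n + 2))) :
    polarRadialCLM n θ z = polarRadial n θ z := rfl

theorem norm_polarRadial_le (n : ℕ) (θ : ℝ) (z : EuclideanSpace ℝ (Fin (n + 2))) :
    ‖polarRadial n θ z‖ ≤ ‖z‖ := by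
  rw [← sq_le_sq₀ (norm_nonneg _) (norm_nonneg _), norm_sq_add_one, norm_sq_add_two]
  simp only [polarRadial_castAdd, polarRadial_zero]
  nlinarith [sq_nonneg (z (Fin.natAdd n 0) * sin θ - z (Fin.natAdd n 1) * cos θ),
    sin_sq_add_cos_sq θ]

theorem contDiff_polarRadial (n : ℕ) {m : WithTop ℕ∞} :
    ContDiff ℝ m (fun p : ℝ × EuclideanSpace ℝ (Fin (n + 2)) => polarRadial n p.1 p.2) := by
  rw [contDiff_euclidean, forall_fin_add_one]
  simp only [polarRadial_castAdd, polarRadial_zero]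
  have h : ∀ i : Fin (n + 2), ContDiff ℝ m
      (fun p : ℝ × EuclideanSpace ℝ (Fin (n + 2)) => p.2 i) := fun i =>
    (EuclideanSpace.proj (𝕜 := ℝ) i).contDiff.comp contDiff_snd
  exact ⟨fun i => h _, ((h _).mul (contDiff_cos.comp contDiff_fst)).add
    ((h _).mul (contDiff_sin.comp contDiff_fst))⟩

theorem castAdd_ne_natAdd {m n : ℕ} (i : Fin n) (j : Fin m) :
    Fin.castAdd m i ≠ Fin.natAdd n j := fun h => by
  have := congrArg Fin.val h
  simp only [Fin.val_castAdd, Fin.val_natAdd] at this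
  omega

theorem polarMap_single_castAdd (n : ℕ) (θ : ℝ) (i : Fin n) :
    polarMap n (EuclideanSpace.single (Fin.castAdd 1 i) 1) θ =
      EuclideanSpace.single (Fin.castAdd 2 i) 1 := by
  ext j
  revert j
  rw [forall_fin_add_two]
  have h : ∀ j : Fin 1, Fin.natAdd n j ≠ Fin.castAdd 1 i := fun j => (castAdd_ne_natAdd _ _).symm
  have h' : ∀ j : Fin 2, Fin.natAdd n j ≠ Fin.castAdd 2 i := fun j => (castAdd_ne_natAdd _ _).symm
  simp only [polarMap_castAdd, polarMap_zero, polarMap_one, PiLp.single_apply, h, h',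
    Fin.castAdd_inj, if_false, zero_mul]
  simp

theorem polarMap_single_natAdd (n : ℕ) (θ : ℝ) :
    polarMap n (EuclideanSpace.single (Fin.natAdd n 0) 1) θ =
      cos θ • EuclideanSpace.single (Fin.natAdd n 0) (1:ℝ) +
        sin θ • EuclideanSpace.single (Fin.natAdd n 1) (1:ℝ) := by
  ext j
  revert j
  rw [forall_fin_add_two]
  have h : ∀ (i : Fin n) (j : Fin 1), Fin.castAdd 1 i ≠ Fin.natAdd n j :=
    castAdd_ne_natAdd
  have h' : ∀ (i : Fin n) (j : Fin 2), Fin.castAdd 2 i ≠ Fin.natAdd n j :=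
    castAdd_ne_natAdd
  simp only [polarMap_castAdd, polarMap_zero, polarMap_one, PiLp.add_apply, PiLp.smul_apply,
    PiLp.single_apply, h, h', Fin.natAdd_inj, if_false]
  simp

theorem hasDerivAt_polarMap (n : ℕ) (y : EuclideanSpace ℝ (Fin (n + 1))) (θ : ℝ) :
    HasDerivAt (fun t => polarMap n y t)
      ((-(y (Fin.natAdd n 0) * sin θ)) • EuclideanSpace.single (Fin.natAdd n 0) (1:ℝ) +
        (y (Fin.natAdd n 0) * cos θ) • EuclideanSpace.single (Fin.natAdd n 1) (1:ℝ)) θ := by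
  have h : (fun t => polarMap n y t) = fun t =>
      (polarMap n y θ - polarMapCLM n θ
        (y (Fin.natAdd n 0) • EuclideanSpace.single (Fin.natAdd n 0) 1)) +
      ((y (Fin.natAdd n 0) * cos t) • EuclideanSpace.single (Fin.natAdd n 0) (1:ℝ) +
        (y (Fin.natAdd n 0) * sin t) • EuclideanSpace.single (Fin.natAdd n 1) (1:ℝ)) := by
    funext t
    rw [map_smul, polarMapCLM_apply, polarMap_single_natAdd]
    ext j
    revert j
    rw [forall_fin_add_two]
    have h' : ∀ (i : Fin n) (j : Fin 2), Fin.castAdd 2 i ≠ Fin.natAdd n j :=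
      castAdd_ne_natAdd
    simp [h', -Fin.natAdd_eq_addNat, -Fin.natAdd_zero, -Fin.castAdd_zero]
  rw [h, ← mul_neg]
  exact ((((hasDerivAt_cos θ).const_mul _).smul_const _).add
    (((hasDerivAt_sin θ).const_mul _).smul_const _)).const_add _

theorem mul_coordDiv_polarMap {n : ℕ}
    {F : EuclideanSpace ℝ (Fin (n + 2)) → EuclideanSpace ℝ (Fin (n + 2))}
    (hF : Differentiable ℝ F) (y : EuclideanSpace ℝ (Fin (n + 1))) (θ : ℝ) :
    y (Fin.natAdd n 0) * coordDiv F (polarMap n y θ) =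
      coordDiv (fun z => z (Fin.natAdd n 0) • polarRadial n θ (F (polarMap n z θ))) y +
        deriv (fun t => F (polarMap n y t) (Fin.natAdd n 1) * cos t -
          F (polarMap n y t) (Fin.natAdd n 0) * sin t) θ := by
  have hA := (hF (polarMap n y θ)).hasFDerivAt
  set A := fderiv ℝ F (polarMap n y θ) with hAdef
  have h1 : HasFDerivAt (fun z : EuclideanSpace ℝ (Fin (n + 1)) =>
      z (Fin.natAdd n 0) • polarRadial n θ (F (polarMap n z θ))) _ y :=
    ((EuclideanSpace.proj (𝕜 := ℝ) (Fin.natAdd n 0)).hasFDerivAt (x := y)).smul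
      ((polarRadialCLM n θ).hasFDerivAt.comp y
        (HasFDerivAt.comp (g := F) y hA (polarMapCLM n θ).hasFDerivAt))
  have h2 : HasDerivAt (fun t => F (polarMap n y t)) _ θ :=
    hA.comp_hasDerivAt θ (hasDerivAt_polarMap n y θ)
  have h3 : ∀ i, HasDerivAt (fun t => F (polarMap n y t) i) _ θ := fun i =>
    ((EuclideanSpace.proj (𝕜 := ℝ) i).hasFDerivAt).comp_hasDerivAt θ h2
  have h4 := ((h3 (Fin.natAdd n 1)).mul (hasDerivAt_cos θ)).sub
    ((h3 (Fin.natAdd n 0)).mul (hasDerivAt_sin θ))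
  refine Eq.trans ?_ (congrArg _ h4.deriv.symm)
  rw [h1.coordDiv_eq, hA.coordDiv_eq, coordTrace_apply, coordTrace_apply, Fin.sum_univ_add,
    Fin.sum_univ_add, Fin.sum_univ_two, Fin.sum_univ_one]
  have h' : ∀ (i : Fin n), Fin.natAdd n (0 : Fin 1) ≠ Fin.castAdd 1 i := fun i =>
    (castAdd_ne_natAdd _ _).symm
  simp [polarMapCLM_apply, polarRadialCLM_apply, polarMap_single_castAdd, polarMap_single_natAdd,
    h', -Fin.natAdd_eq_addNat]
  rw [← Finset.mul_sum]
  linear_combination (-(y (Fin.natAdd n 0) *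
    (A (EuclideanSpace.single (Fin.natAdd n 0) 1) (Fin.natAdd n 0) +
      A (EuclideanSpace.single (Fin.natAdd n 1) 1) (Fin.natAdd n 1)))) * sin_sq_add_cos_sq θ

theorem ContDiff.euclidean_apply {H : Type*} [NormedAddCommGroup H] [NormedSpace ℝ H] {d : ℕ}
    {m : WithTop ℕ∞} {f : H → EuclideanSpace ℝ (Fin d)} (hf : ContDiff ℝ m f) (i : Fin d) :
    ContDiff ℝ m (fun x => f x i) :=
  contDiff_euclidean.1 hf i

theorem contDiff_of_contDiffAt_tsupport {H G : Type*} [NormedAddCommGroup H] [NormedSpace ℝ H]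
    [NormedAddCommGroup G] [NormedSpace ℝ G] {m : WithTop ℕ∞} {f : H → G}
    (hf : ∀ x ∈ tsupport f, ContDiffAt ℝ m f x) : ContDiff ℝ m f := by
  refine contDiff_iff_contDiffAt.2 fun x => ?_
  by_cases hx : x ∈ tsupport f
  · exact hf x hx
  · exact contDiffAt_const.congr_of_eventuallyEq (notMem_tsupport_iff_eventuallyEq.1 hx)

theorem setIntegral_coordDiv_eq {n : ℕ} {Q : Set (EuclideanSpace ℝ (Fin (n + 2)))}
    {K : Set (EuclideanSpace ℝ (Fin (n + 1)))} (hQ : Q ⊆ posOrthant (n + 2))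
    (hK : K ⊆ posOrthant (n + 1))
    (hQK : ∀ y ∈ posOrthant (n + 1), ∀ θ ∈ Ioo (0:ℝ) (π / 2), polarMap n y θ ∈ Q ↔ y ∈ K)
    {F : EuclideanSpace ℝ (Fin (n + 2)) → EuclideanSpace ℝ (Fin (n + 2))}
    (hF : ContDiff ℝ 1 F) (hFc : HasCompactSupport F) (hFs : tsupport F ⊆ posOrthant (n + 2)) :
    ∫ x in Q, coordDiv F x = ∫ y in K, coordDiv (fun z => ∫ θ in (0:ℝ)..(π / 2),
      z (Fin.natAdd n 0) • polarRadial n θ (F (polarMap n z θ))) y := by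
  have hdiv := hF.continuous_coordDiv
  have hdivc : HasCompactSupport (coordDiv F) :=
    hFc.of_isClosed_subset isClosed_closure
      (closure_minimal (support_coordDiv_subset F) isClosed_closure)
  have hint := integrable_polarMap_of_integrableOn hQ hK hQK
    (hdiv.integrable_of_hasCompactSupport hdivc).integrableOn
  rw [setIntegral_eq_integral_polarMap hQ hK hQK hdiv.measurable, integral_prod _ hint]
  congr 1
  funext y
  let g : EuclideanSpace ℝ (Fin (n + 1)) × ℝ → EuclideanSpace ℝ (Fin (n + 1)) := fun p =>
    p.1 (Fin.natAdd n 0) • polarRadial n p.2 (F (polarMap n p.1 p.2))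
  have hFp : ContDiff ℝ 1 (fun p : EuclideanSpace ℝ (Fin (n + 1)) × ℝ =>
    F (polarMap n p.1 p.2)) := hF.comp (contDiff_polarMap n)
  have hg : ContDiff ℝ 1 g := (contDiff_fst.euclidean_apply _).smul
    ((contDiff_polarRadial n).comp (contDiff_snd.prodMk hFp))
  let G : ℝ → ℝ := fun t => F (polarMap n y t) (Fin.natAdd n 1) * cos t -
    F (polarMap n y t) (Fin.natAdd n 0) * sin t
  have hFy : ContDiff ℝ 1 (fun t => F (polarMap n y t)) := hFp.comp (contDiff_prodMk_right y)
  have hG : ContDiff ℝ 1 G := ((hFy.euclidean_apply _).mul contDiff_cos).sub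
    ((hFy.euclidean_apply _).mul contDiff_sin)
  have hF0 : ∀ x, x (Fin.natAdd n 0) = 0 ∨ x (Fin.natAdd n 1) = 0 → F x = 0 := by
    intro x hx
    by_contra h
    have := mem_posOrthant_add_two.1 (hFs (subset_tsupport F h))
    rcases hx with hx | hx
    · exact this.2.1.ne' hx
    · exact this.2.2.ne' hx
  have hG0 : G 0 = 0 := by simp [G, hF0 (polarMap n y 0) (Or.inr (by simp))]
  have hG1 : G (π / 2) = 0 := by simp [G, hF0 (polarMap n y (π / 2)) (Or.inl (by simp))]
  have hpart : ∀ θ, HasFDerivAt (fun z => g (z, θ))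
      ((fderiv ℝ g (y, θ)).comp (ContinuousLinearMap.inl ℝ _ ℝ)) y := fun θ =>
    HasFDerivAt.comp (g := g) y (hg.differentiable one_ne_zero (y, θ)).hasFDerivAt
      (hasFDerivAt_prodMk_left y θ)
  have hcont : Continuous fun θ : ℝ => (fderiv ℝ g (y, θ)).comp
      (ContinuousLinearMap.inl ℝ (EuclideanSpace ℝ (Fin (n + 1))) ℝ) :=
    ((hg.continuous_fderiv one_ne_zero).comp (by fun_prop)).clm_comp continuous_const
  have hL := hasFDerivAt_intervalIntegral_smul (w := fun _ => 1) continuous_const hg 0 (π / 2) y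
  simp only [one_smul] at hL
  rw [← integral_Ioc_eq_integral_Ioo, ← intervalIntegral.integral_of_le (by positivity)]
  simp only [mul_coordDiv_polarMap (hF.differentiable one_ne_zero)]
  have e1 : ∀ θ, coordDiv (fun z => z (Fin.natAdd n 0) • polarRadial n θ (F (polarMap n z θ))) y =
      coordTrace (n + 1) ((fderiv ℝ g (y, θ)).comp (ContinuousLinearMap.inl ℝ _ ℝ)) := fun θ =>
    (hpart θ).coordDiv_eq
  have hT : Continuous fun θ : ℝ => coordTrace (n + 1) ((fderiv ℝ g (y, θ)).comp
      (ContinuousLinearMap.inl ℝ (EuclideanSpace ℝ (Fin (n + 1))) ℝ)) :=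
    (coordTrace (n + 1)).continuous.comp hcont
  simp only [e1]
  change ∫ θ in (0:ℝ)..(π / 2), (_ + deriv G θ) = _
  rw [intervalIntegral.integral_add (hT.intervalIntegrable _ _)
    ((hG.continuous_deriv le_rfl).intervalIntegrable _ _),
    intervalIntegral.integral_deriv_eq_sub' G rfl
    (fun t _ => hG.differentiable one_ne_zero t) (hG.continuous_deriv le_rfl).continuousOn,
    hG0, hG1, sub_zero, add_zero,
    ContinuousLinearMap.intervalIntegral_comp_comm _ (hcont.intervalIntegrable _ _)]
  exact hL.coordDiv_eq.symm

theorem contDiffAt_monomialExpWeight {d : ℕ} (c : ℝ) (k : Fin d → ℝ) {m : WithTop ℕ∞}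
    {x : EuclideanSpace ℝ (Fin d)} (hx : x ∈ posOrthant d) :
    ContDiffAt ℝ m (monomialExpWeight c k) x := by
  refine ContDiffAt.mul ?_ ?_
  · exact (contDiff_const.mul (contDiff_norm_sq ℝ)).exp.contDiffAt
  · refine contDiffAt_prod fun i _ => ?_
    exact (contDiff_id.euclidean_apply i).contDiffAt.rpow_const_of_ne (hx i).ne'

/-- The weighted average over quarter circles of the projected field `v`. -/
noncomputable def angularAverage {n : ℕ} (a : ℝ) (k : Fin (n + 2) → ℝ)
    (v : EuclideanSpace ℝ (Fin (n + 2)) → EuclideanSpace ℝ (Fin (n + 2)))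
    (y : EuclideanSpace ℝ (Fin (n + 1))) : EuclideanSpace ℝ (Fin (n + 1)) :=
  a⁻¹ • ∫ θ in (0:ℝ)..(π / 2), angularWeight k θ • polarRadial n θ (v (polarMap n y θ))

theorem setIntegral_coordDiv_smul_eq {n : ℕ} {Q : Set (EuclideanSpace ℝ (Fin (n + 2)))}
    {K : Set (EuclideanSpace ℝ (Fin (n + 1)))} (hQ : Q ⊆ posOrthant (n + 2))
    (hK : K ⊆ posOrthant (n + 1))
    (hQK : ∀ y ∈ posOrthant (n + 1), ∀ θ ∈ Ioo (0:ℝ) (π / 2), polarMap n y θ ∈ Q ↔ y ∈ K)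
    {a : ℝ} (ha : 0 < a) (c : ℝ) (k : Fin (n + 2) → ℝ)
    {v : EuclideanSpace ℝ (Fin (n + 2)) → EuclideanSpace ℝ (Fin (n + 2))}
    (hv : ContDiff ℝ 1 v) (hvc : HasCompactSupport v) (hvs : tsupport v ⊆ posOrthant (n + 2)) :
    ∫ x in Q, coordDiv (fun z => monomialExpWeight c k z • v z) x =
      ∫ y in K, coordDiv (fun z => reducedWeight a c k z • angularAverage a k v z) y := by
  have hsub : tsupport (fun z => monomialExpWeight c k z • v z) ⊆ tsupport v :=
    tsupport_smul_subset_right _ _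
  have hF : ContDiff ℝ 1 (fun z => monomialExpWeight c k z • v z) :=
    contDiff_of_contDiffAt_tsupport fun x hx =>
      (contDiffAt_monomialExpWeight c k (hvs (hsub hx))).smul hv.contDiffAt
  have hFc : HasCompactSupport (fun z => monomialExpWeight c k z • v z) :=
    hvc.of_isClosed_subset isClosed_closure hsub
  rw [setIntegral_coordDiv_eq hQ hK hQK hF hFc (hsub.trans hvs)]
  refine integral_congr_ae ?_
  filter_upwards [ae_restrict_of_ae_restrict_of_subset hK
    (ae_restrict_mem (isOpen_posOrthant _).measurableSet)] with y hy
  refine Filter.EventuallyEq.coordDiv_eq ?_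
  filter_upwards [(isOpen_posOrthant _).mem_nhds hy] with z hz
  rw [angularAverage, smul_smul, ← intervalIntegral.integral_smul]
  refine intervalIntegral.integral_congr fun θ hθ => ?_
  rw [uIcc_of_le (by positivity)] at hθ
  rw [← polarRadialCLM_apply, map_smul, polarRadialCLM_apply, smul_smul, smul_smul]
  congr 1
  rw [mul_right_comm, ← mul_monomialExpWeight_polarMap a c k hz hθ]
  field_simp

theorem contDiff_angularAverage {n : ℕ} (a : ℝ) {k : Fin (n + 2) → ℝ} (hk : ∀ i, 0 ≤ k i)
    {v : EuclideanSpace ℝ (Fin (n + 2)) → EuclideanSpace ℝ (Fin (n + 2))} (hv : ContDiff ℝ 1 v) :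
    ContDiff ℝ 1 (angularAverage a k v) := by
  refine ContDiff.const_smul a⁻¹ (contDiff_intervalIntegral_smul (g := fun p =>
    polarRadial n p.2 (v (polarMap n p.1 p.2))) (continuous_angularWeight hk) ?_ _ _)
  exact (contDiff_polarRadial n).comp (contDiff_snd.prodMk (hv.comp (contDiff_polarMap n)))

theorem norm_angularAverage_le {n : ℕ} {a : ℝ} {k : Fin (n + 2) → ℝ} (hk : ∀ i, 0 ≤ k i)
    (ha : a = ∫ θ in (0:ℝ)..(π / 2), angularWeight k θ)
    {v : EuclideanSpace ℝ (Fin (n + 2)) → EuclideanSpace ℝ (Fin (n + 2))}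
    (hv : ∀ x, ‖v x‖ ≤ 1) (y : EuclideanSpace ℝ (Fin (n + 1))) :
    ‖angularAverage a k v y‖ ≤ 1 := by
  have ha0 : 0 < a := ha ▸ integral_angularWeight_pos hk
  have hpi : 0 ≤ π / 2 := by positivity
  rw [angularAverage, norm_smul, norm_inv, Real.norm_of_nonneg ha0.le, inv_mul_le_one₀ ha0]
  conv_rhs => rw [ha]
  refine intervalIntegral.norm_integral_le_of_norm_le hpi
    (Filter.Eventually.of_forall fun θ hθ => ?_)
    ((continuous_angularWeight hk).intervalIntegrable _ _)
  have hw := angularWeight_nonneg k (Ioc_subset_Icc_self hθ)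
  rw [norm_smul, Real.norm_of_nonneg hw]
  exact mul_le_of_le_one_right hw ((norm_polarRadial_le _ _ _).trans (hv _))

/-- The projection `(w, s, t) ↦ (w, √(s² + t²))`. -/
noncomputable def cylProj (n : ℕ) (x : EuclideanSpace ℝ (Fin (n + 2))) :
    EuclideanSpace ℝ (Fin (n + 1)) :=
  WithLp.toLp 2 (Fin.append (fun i => x (Fin.castAdd 2 i))
    ![√(x (Fin.natAdd n 0) ^ 2 + x (Fin.natAdd n 1) ^ 2)])

@[simp] theorem cylProj_castAdd (n : ℕ) (x : EuclideanSpace ℝ (Fin (n + 2))) (i : Fin n) :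
    cylProj n x (Fin.castAdd 1 i) = x (Fin.castAdd 2 i) := by
  simp only [cylProj, Fin.append_left]

@[simp] theorem cylProj_zero (n : ℕ) (x : EuclideanSpace ℝ (Fin (n + 2))) :
    cylProj n x (Fin.natAdd n 0) = √(x (Fin.natAdd n 0) ^ 2 + x (Fin.natAdd n 1) ^ 2) := by
  simp only [cylProj, Fin.append_right]; rfl

theorem continuous_cylProj (n : ℕ) : Continuous (cylProj n) := by
  refine (PiLp.continuous_toLp 2 _).comp (continuous_pi ?_)
  rw [forall_fin_add_one]
  simp only [Fin.append_left, Fin.append_right]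
  exact ⟨fun i => by fun_prop, by
    change Continuous fun x : EuclideanSpace ℝ (Fin (n + 2)) =>
      √(x (Fin.natAdd n 0) ^ 2 + x (Fin.natAdd n 1) ^ 2)
    fun_prop⟩

theorem norm_cylProj (n : ℕ) (x : EuclideanSpace ℝ (Fin (n + 2))) : ‖cylProj n x‖ = ‖x‖ := by
  rw [← sq_eq_sq₀ (norm_nonneg _) (norm_nonneg _), norm_sq_add_two, norm_sq_add_one]
  simp only [cylProj_castAdd, cylProj_zero]
  rw [sq_sqrt (by positivity)]

theorem cylProj_polarMap {n : ℕ} {y : EuclideanSpace ℝ (Fin (n + 1))}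
    (hy : 0 ≤ y (Fin.natAdd n 0)) (θ : ℝ) : cylProj n (polarMap n y θ) = y := by
  ext i
  revert i
  rw [forall_fin_add_one]
  simp only [cylProj_castAdd, cylProj_zero, polarMap_castAdd, polarMap_zero, polarMap_one]
  refine ⟨fun i => trivial, ?_⟩
  rw [sqrt_eq_iff_mul_self_eq (by positivity) hy]
  linear_combination y (Fin.natAdd n 0) ^ 2 * sin_sq_add_cos_sq θ

theorem cylProj_mem_posOrthant {n : ℕ} {x : EuclideanSpace ℝ (Fin (n + 2))}
    (hx : x ∈ posOrthant (n + 2)) : cylProj n x ∈ posOrthant (n + 1) := by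
  rw [mem_posOrthant_add_two] at hx
  rw [mem_posOrthant_add_one]
  simp only [cylProj_castAdd, cylProj_zero]
  have := hx.2.1
  exact ⟨hx.1, by positivity⟩

theorem tsupport_angularAverage_subset {n : ℕ} (a : ℝ) (k : Fin (n + 2) → ℝ)
    {v : EuclideanSpace ℝ (Fin (n + 2)) → EuclideanSpace ℝ (Fin (n + 2))}
    (hvc : HasCompactSupport v) (hvs : tsupport v ⊆ posOrthant (n + 2)) :
    tsupport (angularAverage a k v) ⊆ cylProj n '' tsupport v := by
  refine closure_minimal (fun y hy => ?_)
    (IsCompact.image hvc (continuous_cylProj n)).isClosed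
  by_contra h
  refine hy ?_
  rw [angularAverage, intervalIntegral.integral_zero_ae, smul_zero]
  refine Filter.Eventually.of_forall fun θ hθ => ?_
  rw [uIoc_of_le (by positivity)] at hθ
  have hv0 : v (polarMap n y θ) = 0 := by
    by_contra hne
    have hmem := subset_tsupport v hne
    have hpos := (mem_posOrthant_add_two.1 (hvs hmem)).2.1
    rw [polarMap_zero] at hpos
    have hcos : 0 ≤ cos θ := cos_nonneg_of_mem_Icc ⟨by linarith [hθ.1, pi_pos], hθ.2⟩
    exact h ⟨_, hmem, cylProj_polarMap (pos_of_mul_pos_left hpos hcos).le θ⟩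
  rw [hv0, ← polarRadialCLM_apply, map_zero, smul_zero]

/-- The point `(z, r s, r t)` for `w = (z, r)`. -/
noncomputable def sectorMap (n : ℕ) (w : EuclideanSpace ℝ (Fin (n + 1))) (s t : ℝ) :
    EuclideanSpace ℝ (Fin (n + 2)) :=
  WithLp.toLp 2 (Fin.append (fun i => w (Fin.castAdd 1 i))
    ![w (Fin.natAdd n 0) * s, w (Fin.natAdd n 0) * t])

@[simp] theorem sectorMap_castAdd (n : ℕ) (w : EuclideanSpace ℝ (Fin (n + 1))) (s t : ℝ)
    (i : Fin n) : sectorMap n w s t (Fin.castAdd 2 i) = w (Fin.castAdd 1 i) := by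
  simp only [sectorMap, Fin.append_left]

@[simp] theorem sectorMap_zero (n : ℕ) (w : EuclideanSpace ℝ (Fin (n + 1))) (s t : ℝ) :
    sectorMap n w s t (Fin.natAdd n 0) = w (Fin.natAdd n 0) * s := by
  simp only [sectorMap, Fin.append_right]; rfl

@[simp] theorem sectorMap_one (n : ℕ) (w : EuclideanSpace ℝ (Fin (n + 1))) (s t : ℝ) :
    sectorMap n w s t (Fin.natAdd n 1) = w (Fin.natAdd n 0) * t := by
  simp only [sectorMap, Fin.append_right]; rfl

theorem norm_sectorMap_le {n : ℕ} (w : EuclideanSpace ℝ (Fin (n + 1))) {s t : ℝ}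
    (h : s ^ 2 + t ^ 2 ≤ 1) : ‖sectorMap n w s t‖ ≤ ‖w‖ := by
  rw [← sq_le_sq₀ (norm_nonneg _) (norm_nonneg _), norm_sq_add_two, norm_sq_add_one]
  simp only [sectorMap_castAdd, sectorMap_zero, sectorMap_one]
  nlinarith [sq_nonneg (w (Fin.natAdd n 0))]

theorem polarRadial_sectorMap (n : ℕ) (w : EuclideanSpace ℝ (Fin (n + 1))) (θ : ℝ) :
    polarRadial n θ (sectorMap n w (cos θ) (sin θ)) = w := by
  ext i
  revert i
  rw [forall_fin_add_one]
  simp only [polarRadial_castAdd, polarRadial_zero, sectorMap_castAdd, sectorMap_zero,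
    sectorMap_one]
  refine ⟨fun i => trivial, ?_⟩
  linear_combination w (Fin.natAdd n 0) * sin_sq_add_cos_sq θ

theorem contDiff_sectorMap (n : ℕ) {m : WithTop ℕ∞} :
    ContDiff ℝ m (fun p : EuclideanSpace ℝ (Fin (n + 1)) × ℝ × ℝ =>
      sectorMap n p.1 p.2.1 p.2.2) := by
  rw [contDiff_euclidean, forall_fin_add_two]
  simp only [sectorMap_castAdd, sectorMap_zero, sectorMap_one]
  exact ⟨fun i => contDiff_fst.euclidean_apply _,
    (contDiff_fst.euclidean_apply _).mul contDiff_snd.fst,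
    (contDiff_fst.euclidean_apply _).mul contDiff_snd.snd⟩

/-- A smooth cutoff vanishing for `m t ≤ 1` and equal to `1` for `m t ≥ 2`. -/
noncomputable def scaledCutoff (m : ℕ) (t : ℝ) : ℝ := smoothTransition (m * t - 1)

theorem contDiff_scaledCutoff (m : ℕ) {r : ℕ∞} : ContDiff ℝ r (scaledCutoff m) :=
  smoothTransition.contDiff.comp ((contDiff_const.mul contDiff_id).sub contDiff_const)

theorem scaledCutoff_nonneg (m : ℕ) (t : ℝ) : 0 ≤ scaledCutoff m t := smoothTransition.nonneg _

theorem scaledCutoff_le_one (m : ℕ) (t : ℝ) : scaledCutoff m t ≤ 1 := smoothTransition.le_one _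

theorem one_lt_of_scaledCutoff_ne_zero {m : ℕ} {t : ℝ} (h : scaledCutoff m t ≠ 0) :
    1 < m * t := by
  by_contra hle
  exact h (smoothTransition.zero_of_nonpos (by linarith))

theorem eventually_scaledCutoff_eq_one {t : ℝ} (ht : 0 < t) :
    ∀ᶠ m : ℕ in Filter.atTop, scaledCutoff m t = 1 := by
  filter_upwards [Filter.eventually_ge_atTop ⌈2 / t⌉₊] with m hm
  have h : 2 / t ≤ m := (Nat.le_ceil _).trans (by exact_mod_cast hm)
  rw [div_le_iff₀ ht] at h
  exact smoothTransition.one_of_one_le (by linarith)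

/-- The lift of a field on the reduced orthant, cut off near the faces of the quadrant formed by
the last two coordinates. -/
noncomputable def sectorLift (n m : ℕ)
    (u : EuclideanSpace ℝ (Fin (n + 1)) → EuclideanSpace ℝ (Fin (n + 1)))
    (x : EuclideanSpace ℝ (Fin (n + 2))) : EuclideanSpace ℝ (Fin (n + 2)) :=
  (scaledCutoff m (x (Fin.natAdd n 0) / cylProj n x (Fin.natAdd n 0)) *
    scaledCutoff m (x (Fin.natAdd n 1) / cylProj n x (Fin.natAdd n 0))) •
    sectorMap n (u (cylProj n x)) (x (Fin.natAdd n 0) / cylProj n x (Fin.natAdd n 0))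
      (x (Fin.natAdd n 1) / cylProj n x (Fin.natAdd n 0))

theorem norm_sectorLift_le {n : ℕ} (m : ℕ)
    {u : EuclideanSpace ℝ (Fin (n + 1)) → EuclideanSpace ℝ (Fin (n + 1))}
    (hu : ∀ y, ‖u y‖ ≤ 1) (x : EuclideanSpace ℝ (Fin (n + 2))) : ‖sectorLift n m u x‖ ≤ 1 := by
  rw [sectorLift, norm_smul]
  refine mul_le_one₀ ?_ (norm_nonneg _) ((norm_sectorMap_le _ ?_).trans (hu _))
  · rw [Real.norm_of_nonneg (mul_nonneg (scaledCutoff_nonneg _ _) (scaledCutoff_nonneg _ _))]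
    exact mul_le_one₀ (scaledCutoff_le_one _ _) (scaledCutoff_nonneg _ _)
      (scaledCutoff_le_one _ _)
  · rw [cylProj_zero, div_pow, div_pow, ← add_div, sq_sqrt (by positivity)]
    exact div_self_le_one _

theorem tsupport_sectorLift_subset {n : ℕ} (m : ℕ)
    {u : EuclideanSpace ℝ (Fin (n + 1)) → EuclideanSpace ℝ (Fin (n + 1))}
    (hus : tsupport u ⊆ posOrthant (n + 1)) :
    tsupport (sectorLift n m u) ⊆ {x | cylProj n x ∈ tsupport u ∧
      cylProj n x (Fin.natAdd n 0) ≤ m * x (Fin.natAdd n 0) ∧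
      cylProj n x (Fin.natAdd n 0) ≤ m * x (Fin.natAdd n 1)} := by
  have hc := continuous_cylProj n
  have hle : ∀ i, IsClosed {x | cylProj n x (Fin.natAdd n 0) ≤ m * x i} := fun i =>
    isClosed_le (by fun_prop) (by fun_prop)
  refine closure_minimal (fun x hx => ?_)
    (((isClosed_tsupport u).preimage hc).inter ((hle _).inter (hle _)))
  rw [Function.mem_support, sectorLift, smul_ne_zero_iff, mul_ne_zero_iff] at hx
  obtain ⟨⟨h1, h2⟩, h3⟩ := hx
  have hmem : cylProj n x ∈ tsupport u := by
    refine subset_tsupport u fun h0 => h3 ?_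
    rw [h0, ← norm_le_zero_iff]
    refine (norm_sectorMap_le _ ?_).trans_eq norm_zero
    rw [cylProj_zero, div_pow, div_pow, ← add_div, sq_sqrt (by positivity)]
    exact div_self_le_one _
  have hρ : 0 < cylProj n x (Fin.natAdd n 0) := hus hmem _
  have h1 := one_lt_of_scaledCutoff_ne_zero h1
  have h2 := one_lt_of_scaledCutoff_ne_zero h2
  rw [← mul_div_assoc, one_lt_div hρ] at h1 h2
  exact ⟨hmem, h1.le, h2.le⟩

theorem tsupport_sectorLift_subset_posOrthant {n : ℕ} (m : ℕ)
    {u : EuclideanSpace ℝ (Fin (n + 1)) → EuclideanSpace ℝ (Fin (n + 1))}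
    (hus : tsupport u ⊆ posOrthant (n + 1)) :
    tsupport (sectorLift n m u) ⊆ posOrthant (n + 2) := by
  intro x hx
  obtain ⟨hmem, h1, h2⟩ := tsupport_sectorLift_subset m hus hx
  have hpos := mem_posOrthant_add_one.1 (hus hmem)
  rw [mem_posOrthant_add_two]
  refine ⟨fun i => ?_, pos_of_mul_pos_right (hpos.2.trans_le h1) m.cast_nonneg,
    pos_of_mul_pos_right (hpos.2.trans_le h2) m.cast_nonneg⟩
  simpa only [cylProj_castAdd] using hpos.1 i

theorem HasCompactSupport.sectorLift {n : ℕ} (m : ℕ)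
    {u : EuclideanSpace ℝ (Fin (n + 1)) → EuclideanSpace ℝ (Fin (n + 1))}
    (huc : HasCompactSupport u) (hus : tsupport u ⊆ posOrthant (n + 1)) :
    HasCompactSupport (sectorLift n m u) := by
  obtain ⟨r, hr⟩ := (IsCompact.isBounded huc).exists_norm_le
  refine (isCompact_closedBall (0 : EuclideanSpace ℝ (Fin (n + 2))) r).of_isClosed_subset
    (isClosed_tsupport _) fun x hx => ?_
  rw [mem_closedBall_zero_iff, ← norm_cylProj]
  exact hr _ (tsupport_sectorLift_subset m hus hx).1

theorem contDiffAt_cylProj {n : ℕ} {m : WithTop ℕ∞} {x : EuclideanSpace ℝ (Fin (n + 2))}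
    (hx : x ∈ posOrthant (n + 2)) : ContDiffAt ℝ m (cylProj n) x := by
  have := (mem_posOrthant_add_two.1 hx).2.1
  rw [contDiffAt_euclidean, forall_fin_add_one]
  simp only [cylProj_castAdd, cylProj_zero]
  have h : ∀ i : Fin (n + 2), ContDiffAt ℝ m
      (fun x : EuclideanSpace ℝ (Fin (n + 2)) => x i) x := fun i =>
    (contDiff_id.euclidean_apply i).contDiffAt
  exact ⟨fun i => h _, (((h _).pow 2).add ((h _).pow 2)).sqrt (by positivity)⟩

theorem contDiff_sectorLift {n : ℕ} (m : ℕ)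
    {u : EuclideanSpace ℝ (Fin (n + 1)) → EuclideanSpace ℝ (Fin (n + 1))}
    (hu : ContDiff ℝ 1 u) (hus : tsupport u ⊆ posOrthant (n + 1)) :
    ContDiff ℝ 1 (sectorLift n m u) := by
  refine contDiff_of_contDiffAt_tsupport fun x hx => ?_
  have hx := tsupport_sectorLift_subset_posOrthant m hus hx
  have hp := contDiffAt_cylProj (m := 1) hx
  have hq : ∀ i, ContDiffAt ℝ 1 (fun x : EuclideanSpace ℝ (Fin (n + 2)) =>
      x i / cylProj n x (Fin.natAdd n 0)) x := fun i =>
    (contDiff_id.euclidean_apply i).contDiffAt.div (contDiffAt_euclidean.1 hp _)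
      (cylProj_mem_posOrthant hx _).ne'
  have hη : ContDiff ℝ 1 (scaledCutoff m) := contDiff_scaledCutoff m
  exact ((hη.contDiffAt.comp x (hq _)).mul (hη.contDiffAt.comp x (hq _))).smul
    (ContDiffAt.comp (g := fun p : EuclideanSpace ℝ (Fin (n + 1)) × ℝ × ℝ =>
      sectorMap n p.1 p.2.1 p.2.2) x (contDiff_sectorMap n).contDiffAt
      ((hu.contDiffAt.comp x hp).prodMk ((hq _).prodMk (hq _))))

/-- The mean of the cutoff over the quarter circle. -/
noncomputable def cutoffMean {n : ℕ} (a : ℝ) (k : Fin (n + 2) → ℝ) (m : ℕ) : ℝ :=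
  a⁻¹ * ∫ θ in (0:ℝ)..(π / 2),
    angularWeight k θ * (scaledCutoff m (cos θ) * scaledCutoff m (sin θ))

theorem angularAverage_sectorLift {n : ℕ} (a : ℝ) (k : Fin (n + 2) → ℝ) (m : ℕ)
    (u : EuclideanSpace ℝ (Fin (n + 1)) → EuclideanSpace ℝ (Fin (n + 1)))
    {y : EuclideanSpace ℝ (Fin (n + 1))} (hy : y ∈ posOrthant (n + 1)) :
    angularAverage a k (sectorLift n m u) y = cutoffMean a k m • u y := by
  have hr : 0 < y (Fin.natAdd n 0) := hy _
  rw [angularAverage, cutoffMean, mul_smul, ← intervalIntegral.integral_smul_const]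
  congr 2
  funext θ
  rw [sectorLift, cylProj_polarMap hr.le, polarMap_zero, polarMap_one,
    mul_div_cancel_left₀ _ hr.ne', mul_div_cancel_left₀ _ hr.ne', ← polarRadialCLM_apply,
    map_smul, polarRadialCLM_apply, polarRadial_sectorMap, smul_smul]

theorem tendsto_cutoffMean {n : ℕ} {a : ℝ} {k : Fin (n + 2) → ℝ} (hk : ∀ i, 0 ≤ k i)
    (ha : a = ∫ θ in (0:ℝ)..(π / 2), angularWeight k θ) :
    Filter.Tendsto (cutoffMean a k) Filter.atTop (nhds 1) := by
  have ha0 : 0 < a := ha ▸ integral_angularWeight_pos hk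
  have hpi := pi_pos
  have hw := continuous_angularWeight hk
  have hη : ∀ m, Continuous (scaledCutoff m) := fun m =>
    (contDiff_scaledCutoff m (r := 0)).continuous
  suffices h : Filter.Tendsto (fun m => ∫ θ in (0:ℝ)..(π / 2),
      angularWeight k θ * (scaledCutoff m (cos θ) * scaledCutoff m (sin θ))) Filter.atTop
      (nhds (∫ θ in (0:ℝ)..(π / 2), angularWeight k θ)) by
    rw [← ha] at h
    have h' := h.const_mul a⁻¹
    rwa [inv_mul_cancel₀ ha0.ne'] at h'
  refine intervalIntegral.tendsto_integral_filter_of_dominated_convergence (angularWeight k)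
    ?_ ?_ (hw.intervalIntegrable _ _) ?_
  · exact Filter.Eventually.of_forall fun m =>
      (hw.mul (((hη m).comp continuous_cos).mul ((hη m).comp continuous_sin))).aestronglyMeasurable
  · refine Filter.Eventually.of_forall fun m => Filter.Eventually.of_forall fun θ hθ => ?_
    rw [uIoc_of_le (by positivity)] at hθ
    have h0 := angularWeight_nonneg k (Ioc_subset_Icc_self hθ)
    have h1 := scaledCutoff_nonneg m
    rw [Real.norm_of_nonneg (mul_nonneg h0 (mul_nonneg (h1 _) (h1 _)))]
    exact mul_le_of_le_one_right h0 (mul_le_one₀ (scaledCutoff_le_one _ _) (h1 _)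
      (scaledCutoff_le_one _ _))
  · filter_upwards [Measure.ae_ne volume (π / 2)] with θ hne hθ
    rw [uIoc_of_le (by positivity)] at hθ
    have hlt : θ < π / 2 := lt_of_le_of_ne hθ.2 hne
    refine tendsto_const_nhds.congr' ?_
    filter_upwards [eventually_scaledCutoff_eq_one
      (cos_pos_of_mem_Ioo (x := θ) ⟨by linarith [hθ.1], hlt⟩),
      eventually_scaledCutoff_eq_one
      (sin_pos_of_pos_of_lt_pi (x := θ) hθ.1 (by linarith))] with m h1 h2
    rw [h1, h2, mul_one, mul_one]

theorem coordDiv_const_smul {d : ℕ} (t : ℝ)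
    (F : EuclideanSpace ℝ (Fin d) → EuclideanSpace ℝ (Fin d)) (x : EuclideanSpace ℝ (Fin d)) :
    coordDiv (fun z => t • F z) x = t * coordDiv F x := by
  simp only [coordDiv, PiLp.smul_apply, smul_eq_mul, Finset.mul_sum]
  refine Finset.sum_congr rfl fun i _ => ?_
  exact congrArg (fun L : EuclideanSpace ℝ (Fin d) →L[ℝ] ℝ => L (EuclideanSpace.single i 1))
    (congrFun (fderiv_const_smul_field (f := fun y => F y i) t) x)

theorem setIntegral_coordDiv_sectorLift {n : ℕ} {Q : Set (EuclideanSpace ℝ (Fin (n + 2)))}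
    {K : Set (EuclideanSpace ℝ (Fin (n + 1)))} (hQ : Q ⊆ posOrthant (n + 2))
    (hK : K ⊆ posOrthant (n + 1))
    (hQK : ∀ y ∈ posOrthant (n + 1), ∀ θ ∈ Ioo (0:ℝ) (π / 2), polarMap n y θ ∈ Q ↔ y ∈ K)
    {a : ℝ} (ha : 0 < a) (c : ℝ) (k : Fin (n + 2) → ℝ) (m : ℕ)
    {u : EuclideanSpace ℝ (Fin (n + 1)) → EuclideanSpace ℝ (Fin (n + 1))}
    (hu : ContDiff ℝ 1 u) (huc : HasCompactSupport u) (hus : tsupport u ⊆ posOrthant (n + 1)) :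
    ∫ x in Q, coordDiv (fun z => monomialExpWeight c k z • sectorLift n m u z) x =
      cutoffMean a k m * ∫ y in K, coordDiv (fun z => reducedWeight a c k z • u z) y := by
  rw [setIntegral_coordDiv_smul_eq hQ hK hQK ha c k (contDiff_sectorLift m hu hus)
    (huc.sectorLift m hus) (tsupport_sectorLift_subset_posOrthant m hus),
    ← integral_const_mul]
  refine integral_congr_ae ?_
  filter_upwards [ae_restrict_of_ae_restrict_of_subset hK
    (ae_restrict_mem (isOpen_posOrthant _).measurableSet)] with y hy
  rw [← coordDiv_const_smul]
  refine Filter.EventuallyEq.coordDiv_eq ?_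
  filter_upwards [(isOpen_posOrthant _).mem_nhds hy] with z hz
  rw [angularAverage_sectorLift a k m u hz, smul_comm]

theorem sSup_eq_of_subset_of_subset_closure {S T : Set ℝ} (hS : S.Nonempty) (hST : S ⊆ T)
    (hTS : T ⊆ closure S) : sSup S = sSup T := by
  by_cases hb : BddAbove S
  · exact ((isLUB_iff_of_subset_of_subset_closure hST hTS).1 (isLUB_csSup hS hb)).csSup_eq
      (hS.mono hST) |>.symm
  · rw [Real.sSup_of_not_bddAbove hb, Real.sSup_of_not_bddAbove fun h => hb (h.mono hST)]

theorem wPerim_eq_wPerim {n : ℕ} {Q : Set (EuclideanSpace ℝ (Fin (n + 2)))}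
    {K : Set (EuclideanSpace ℝ (Fin (n + 1)))} (hQ : Q ⊆ posOrthant (n + 2))
    (hK : K ⊆ posOrthant (n + 1))
    (hQK : ∀ y ∈ posOrthant (n + 1), ∀ θ ∈ Ioo (0:ℝ) (π / 2), polarMap n y θ ∈ Q ↔ y ∈ K)
    {a : ℝ} (c : ℝ) {k : Fin (n + 2) → ℝ} (hk : ∀ i, 0 ≤ k i)
    (ha : a = ∫ θ in (0:ℝ)..(π / 2), angularWeight k θ) :
    wPerim (monomialExpWeight c k) (posOrthant (n + 2)) Q =
      wPerim (reducedWeight a c k) (posOrthant (n + 1)) K := by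
  have ha0 : 0 < a := ha ▸ integral_angularWeight_pos hk
  refine sSup_eq_of_subset_of_subset_closure ?_ ?_ ?_
  · exact ⟨_, 0, contDiff_const, HasCompactSupport.zero, by simp [tsupport], by simp, rfl⟩
  · rintro _ ⟨v, hv, hvc, hvs, hv1, rfl⟩
    have hsub := tsupport_angularAverage_subset a k hvc hvs
    refine ⟨angularAverage a k v, contDiff_angularAverage a hk hv,
      (IsCompact.image hvc (continuous_cylProj n)).of_isClosed_subset (isClosed_tsupport _) hsub,
      hsub.trans ?_, norm_angularAverage_le hk ha hv1,
      setIntegral_coordDiv_smul_eq hQ hK hQK ha0 c k hv hvc hvs⟩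
    rintro _ ⟨x, hx, rfl⟩
    exact cylProj_mem_posOrthant (hvs hx)
  · rintro _ ⟨u, hu, huc, hus, hu1, rfl⟩
    have hlim := (tendsto_cutoffMean hk ha).mul_const
      (∫ y in K, coordDiv (fun z => reducedWeight a c k z • u z) y)
    rw [one_mul] at hlim
    refine mem_closure_of_tendsto hlim (Filter.Eventually.of_forall fun m => ?_)
    exact ⟨sectorLift n m u, contDiff_sectorLift m hu hus, huc.sectorLift m hus,
      tsupport_sectorLift_subset_posOrthant m hus, norm_sectorLift_le m hu1,
      (setIntegral_coordDiv_sectorLift hQ hK hQK ha0 c k m hu huc hus).symm⟩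

theorem stmt_18 (n : ℕ) (hn : 1 ≤ n) (c : ℝ) (hc : 0 ≤ c)
    (k : Fin (n + 2) → ℝ) (hk : ∀ i, 0 ≤ k i)
    (a : ℝ)
    (ha : a = ∫ θ in (0:ℝ)..(π / 2),
        Real.cos θ ^ k (Fin.natAdd n 0) * Real.sin θ ^ k (Fin.natAdd n 1))
    (Wtop : Set (EuclideanSpace ℝ (Fin (n + 2)))) (hWtop : Wtop = {x | ∀ i, 0 < x i})
    (Wlow : Set (EuclideanSpace ℝ (Fin (n + 1)))) (hWlow : Wlow = {y | ∀ i, 0 < y i})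
    (φ : EuclideanSpace ℝ (Fin (n + 2)) → ℝ)
    (hφ : φ = fun x => Real.exp (c * ‖x‖ ^ 2) * ∏ i, x i ^ k i)
    (αw : EuclideanSpace ℝ (Fin (n + 1)) → ℝ)
    (hαw : αw = fun y => a *
        y (Fin.natAdd n 0) ^ (k (Fin.natAdd n 0) + k (Fin.natAdd n 1) + 1) *
        Real.exp (c * ‖y‖ ^ 2) *
        ∏ i : Fin n, y (Fin.castAdd 1 i) ^ k (Fin.castAdd 2 i))
    (M' : Set (Fin n → ℝ)) (hM' : ∀ x' ∈ M', ∀ i, 0 < x' i)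
    (R : (Fin n → ℝ) → ℝ) (hR : ∀ x' ∈ M', 0 < R x')
    (Q : Set (EuclideanSpace ℝ (Fin (n + 2))))
    (hQ : Q = {x | (fun i => x (Fin.castAdd 2 i)) ∈ M' ∧
        0 < x (Fin.natAdd n 0) ∧ 0 < x (Fin.natAdd n 1) ∧
        x (Fin.natAdd n 0) ^ 2 + x (Fin.natAdd n 1) ^ 2 <
          R (fun i => x (Fin.castAdd 2 i)) ^ 2})
    (K : Set (EuclideanSpace ℝ (Fin (n + 1))))
    (hK : K = {y | (fun i => y (Fin.castAdd 1 i)) ∈ M' ∧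
        0 < y (Fin.natAdd n 0) ∧ y (Fin.natAdd n 0) < R (fun i => y (Fin.castAdd 1 i))}) :
    (∫ x in Q, φ x) = (∫ y in K, αw y) ∧
    wPerim φ Wtop Q = wPerim αw Wlow K := by
  subst hWtop hWlow hφ hαw
  have hQ' : Q ⊆ posOrthant (n + 2) := by
    rw [hQ]
    exact fun x hx => mem_posOrthant_add_two.2 ⟨hM' _ hx.1, hx.2.1, hx.2.2.1⟩
  have hK' : K ⊆ posOrthant (n + 1) := by
    rw [hK]
    exact fun y hy => mem_posOrthant_add_one.2 ⟨hM' _ hy.1, hy.2.1⟩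
  have hQK : ∀ y ∈ posOrthant (n + 1), ∀ θ ∈ Ioo (0:ℝ) (π / 2),
      polarMap n y θ ∈ Q ↔ y ∈ K := by
    intro y hy θ hθ
    have hpos := (mem_posOrthant_add_two.1 (polarMap_mem_posOrthant hy hθ)).2
    have hr := (mem_posOrthant_add_one.1 hy).2
    have hsq : polarMap n y θ (Fin.natAdd n 0) ^ 2 + polarMap n y θ (Fin.natAdd n 1) ^ 2 =
        y (Fin.natAdd n 0) ^ 2 := by
      rw [polarMap_zero, polarMap_one]
      linear_combination y (Fin.natAdd n 0) ^ 2 * sin_sq_add_cos_sq θ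
    rw [hQ, hK, mem_ofPred_eq, mem_ofPred_eq, hsq]
    simp only [polarMap_castAdd, hpos.1, hpos.2, hr, true_and]
    exact and_congr_right fun h => sq_lt_sq₀ hr.le (hR _ h).le
  exact ⟨setIntegral_monomialExpWeight_eq hQ' hK' hQK c hk ha,
    wPerim_eq_wPerim hQ' hK' hQK c hk ha⟩
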